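/- arXiv:1803.02448 — 2 statements merged into one kernel-verified Lean document; each statement's English description precedes it below -/
import Mathlib

section
/- Let H ∈ C¹(ℝ^m,ℝ^m) with ∂_iH_j = ∂_jH_i, and let u = (u_1,…,u_m), u_i ∈ C³(ℝ²), be a stable solution of Δ_G u_i = H_i(u) on ℝ² such that the system is orientable along u. Assume that for every i: (Z(Yu_i))·(Xu_i) − (Z(Xu_i))·(Yu_i) ≤ 0 everywhere; |∇_G u_i(p)| ≠ 0 for every p ∈ ℝ²; and there is a constant C with ∫_{B_R} x²·|∇_G u_i|² dxdy ≤ C·R⁴ for all R > 1. Then each u_i depends only on the variable x: ∂_y u_i ≡ 0 on ℝ², i.e. u_i(x,y) = u_i(x,y′) for all x, y, y′ ∈ ℝ. -/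
open MeasureTheory Real Filter

/-- Partial derivative in the `x`-variable. -/
noncomputable def pdx (u : ℝ × ℝ → ℝ) (p : ℝ × ℝ) : ℝ :=
  deriv (fun t => u (t, p.2)) p.1

/-- Partial derivative in the `y`-variable. -/
noncomputable def pdy (u : ℝ × ℝ → ℝ) (p : ℝ × ℝ) : ℝ :=
  deriv (fun t => u (p.1, t)) p.2

/-- The Grushin vector field `X u = ∂ₓ u`. -/
noncomputable def Xg (u : ℝ × ℝ → ℝ) (p : ℝ × ℝ) : ℝ := pdx u p

/-- The Grushin vector field `Y u = x·∂_y u`. -/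
noncomputable def Yg (u : ℝ × ℝ → ℝ) (p : ℝ × ℝ) : ℝ := p.1 * pdy u p

/-- The commutator field `Z u = ∂_y u`. -/
noncomputable def Zg (u : ℝ × ℝ → ℝ) (p : ℝ × ℝ) : ℝ := pdy u p

/-- The Grushin Laplacian `Δ_G u = X(Xu) + Y(Yu)`. -/
noncomputable def deltaG (u : ℝ × ℝ → ℝ) (p : ℝ × ℝ) : ℝ := Xg (Xg u) p + Yg (Yg u) p

/-- The norm of the Grushin gradient, `|∇_G u| = √((Xu)² + (Yu)²)`. -/
noncomputable def normG (u : ℝ × ℝ → ℝ) (p : ℝ × ℝ) : ℝ :=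
  Real.sqrt ((Xg u p) ^ 2 + (Yg u p) ^ 2)

/-- The `j`-th partial derivative of a function `H : ℝ^m → ℝ`. -/
noncomputable def pdH {m : ℕ} (H : (Fin m → ℝ) → ℝ) (j : Fin m) (v : Fin m → ℝ) : ℝ :=
  fderiv ℝ H v (Pi.single j 1)

/-- Intrinsic curvature `𝒜` of the level sets. -/
noncomputable def curvA (u : ℝ × ℝ → ℝ) (p : ℝ × ℝ) : ℝ :=
  ((normG u p) ^ 3)⁻¹ *
    (Xg (Xg u) p * (Yg u p) ^ 2 - Xg (Yg u) p * Xg u p * Yg u p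
      - Yg (Xg u) p * Xg u p * Yg u p + Yg (Yg u) p * (Xg u p) ^ 2)

/-- Intrinsic tangential quantity `ℬ` of the level sets. -/
noncomputable def curvB (u : ℝ × ℝ → ℝ) (p : ℝ × ℝ) : ℝ :=
  ((normG u p) ^ 3)⁻¹ *
    (Xg (Xg u) p * Xg u p * Yg u p - Xg (Yg u) p * (Xg u p) ^ 2
      + Yg (Xg u) p * (Yg u p) ^ 2 - Yg (Yg u) p * Xg u p * Yg u p)

/-- The Grushin ball `B_R = {(x,y) : x⁴ + y² < R⁴}`. -/
def ballG (R : ℝ) : Set (ℝ × ℝ) := {p : ℝ × ℝ | p.1 ^ 4 + p.2 ^ 2 < R ^ 4}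

/-- The Grushin norm `‖(x,y)‖_G = (x⁴+y²)^(1/4)`. -/
noncomputable def grushinNorm (p : ℝ × ℝ) : ℝ := (p.1 ^ 4 + p.2 ^ 2) ^ ((1 : ℝ) / 4)

lemma hasDerivAt_pdx {f : ℝ × ℝ → ℝ} (hf : Differentiable ℝ f) (p : ℝ × ℝ) :
    HasDerivAt (fun t => f (t, p.2)) (pdx f p) p.1 :=
  DifferentiableAt.hasDerivAt (by fun_prop)

lemma hasDerivAt_pdy {f : ℝ × ℝ → ℝ} (hf : Differentiable ℝ f) (p : ℝ × ℝ) :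
    HasDerivAt (fun t => f (p.1, t)) (pdy f p) p.2 :=
  DifferentiableAt.hasDerivAt (by fun_prop)

lemma pdx_eq_fderiv {f : ℝ × ℝ → ℝ} (hf : Differentiable ℝ f) :
    pdx f = fun p => fderiv ℝ f p (1, 0) := by
  funext p
  exact ((hf p).hasFDerivAt.comp_hasDerivAt p.1
    ((hasDerivAt_id p.1).prodMk (hasDerivAt_const p.1 p.2))).deriv

lemma pdy_eq_fderiv {f : ℝ × ℝ → ℝ} (hf : Differentiable ℝ f) :
    pdy f = fun p => fderiv ℝ f p (0, 1) := by
  funext p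
  exact ((hf p).hasFDerivAt.comp_hasDerivAt p.2
    ((hasDerivAt_const p.2 p.1).prodMk (hasDerivAt_id p.2))).deriv

lemma contDiff_pdx {f : ℝ × ℝ → ℝ} {n : ℕ} (hf : ContDiff ℝ (n + 1) f) :
    ContDiff ℝ n (pdx f) := by
  rw [pdx_eq_fderiv (hf.differentiable (by simp))]
  exact (hf.fderiv_right le_rfl).clm_apply contDiff_const

lemma contDiff_pdy {f : ℝ × ℝ → ℝ} {n : ℕ} (hf : ContDiff ℝ (n + 1) f) :
    ContDiff ℝ n (pdy f) := by
  rw [pdy_eq_fderiv (hf.differentiable (by simp))]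
  exact (hf.fderiv_right le_rfl).clm_apply contDiff_const

lemma continuous_pdx {f : ℝ × ℝ → ℝ} (hf : ContDiff ℝ 1 f) : Continuous (pdx f) :=
  (contDiff_pdx (n := 0) (by simpa using hf)).continuous

lemma continuous_pdy {f : ℝ × ℝ → ℝ} (hf : ContDiff ℝ 1 f) : Continuous (pdy f) :=
  (contDiff_pdy (n := 0) (by simpa using hf)).continuous

lemma pdx_pdy_comm {f : ℝ × ℝ → ℝ} (hf : ContDiff ℝ 2 f) : pdx (pdy f) = pdy (pdx f) := by
  have h1 : Differentiable ℝ f := hf.differentiable (by simp)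
  have h2 : Differentiable ℝ (fderiv ℝ f) :=
    (hf.fderiv_right (m := 1) (by norm_num)).differentiable (by simp)
  have hx : ContDiff ℝ 1 (pdx f) := contDiff_pdx (n := 1) (by simpa [one_add_one_eq_two] using hf)
  have hy : ContDiff ℝ 1 (pdy f) := contDiff_pdy (n := 1) (by simpa [one_add_one_eq_two] using hf)
  rw [pdx_eq_fderiv (hy.differentiable (by simp)), pdy_eq_fderiv (hx.differentiable (by simp)),
    pdx_eq_fderiv h1, pdy_eq_fderiv h1]
  funext p
  have key (v w : ℝ × ℝ) :
      fderiv ℝ (fun q => fderiv ℝ f q v) p w = fderiv ℝ (fderiv ℝ f) p w v := by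
    rw [fderiv_clm_apply (h2 p) (by fun_prop)]
    simp
  rw [key, key]
  exact (hf.contDiffAt.isSymmSndFDerivAt (by simp)) _ _

lemma HasCompactSupport.pdx {f : ℝ × ℝ → ℝ} (hf : Differentiable ℝ f)
    (hc : HasCompactSupport f) : HasCompactSupport (pdx f) := by
  rw [pdx_eq_fderiv hf]
  exact hc.fderiv_apply ℝ (1, 0)

lemma HasCompactSupport.pdy {f : ℝ × ℝ → ℝ} (hf : Differentiable ℝ f)
    (hc : HasCompactSupport f) : HasCompactSupport (pdy f) := by
  rw [pdy_eq_fderiv hf]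
  exact hc.fderiv_apply ℝ (0, 1)

lemma integral_fderiv_apply_eq_zero {f : ℝ × ℝ → ℝ} (hf : ContDiff ℝ 1 f)
    (hc : HasCompactSupport f) (v : ℝ × ℝ) : ∫ p, fderiv ℝ f p v = 0 := by
  have h := integral_mul_fderiv_eq_neg_fderiv_mul_of_integrable (μ := volume) (v := v)
    (f := fun _ : ℝ × ℝ => (1 : ℝ)) (g := f) (by simp)
    (by simpa using ((hf.continuous_fderiv (by simp)).clm_apply
      continuous_const).integrable_of_hasCompactSupport (hc.fderiv_apply ℝ v))
    (by simpa using hf.continuous.integrable_of_hasCompactSupport hc)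
    (fun x _ => by fun_prop) (fun x _ => hf.differentiable (by simp) x)
  simpa using h

lemma integral_pdx_eq_zero {f : ℝ × ℝ → ℝ} (hf : ContDiff ℝ 1 f) (hc : HasCompactSupport f) :
    ∫ p, pdx f p = 0 := by
  rw [pdx_eq_fderiv (hf.differentiable (by simp))]
  exact integral_fderiv_apply_eq_zero hf hc _

lemma integral_pdy_eq_zero {f : ℝ × ℝ → ℝ} (hf : ContDiff ℝ 1 f) (hc : HasCompactSupport f) :
    ∫ p, pdy f p = 0 := by
  rw [pdy_eq_fderiv (hf.differentiable (by simp))]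
  exact integral_fderiv_apply_eq_zero hf hc _

/-- A Picone-type identity for the product of a cutoff `η` and a signed modulus `g` of a nonvanishing
vector function `(a, b)`. -/
lemma grushin_energy_modulus_identity {a b g η : ℝ × ℝ → ℝ} (ha : ContDiff ℝ 2 a)
    (hb : ContDiff ℝ 2 b) (hg : ContDiff ℝ 1 g) (hη : ContDiff ℝ 1 η) (hg0 : ∀ p, g p ≠ 0)
    (hgsq : ∀ p, g p ^ 2 = a p ^ 2 + b p ^ 2) (p : ℝ × ℝ) :
    Xg (fun q => g q * η q) p ^ 2 + Yg (fun q => g q * η q) p ^ 2 =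
      g p ^ 2 * (Xg η p ^ 2 + Yg η p ^ 2)
      + (pdx (fun q => η q ^ 2 * (a q * pdx a q + b q * pdx b q)) p
        + pdy (fun q => q.1 ^ 2 * (η q ^ 2 * (a q * pdy a q + b q * pdy b q))) p)
      - η p ^ 2 * (((a p * Xg b p - b p * Xg a p) / g p) ^ 2
        + ((a p * Yg b p - b p * Yg a p) / g p) ^ 2)
      - η p ^ 2 * (a p * deltaG a p + b p * deltaG b p) := by
  have ha1 := ha.differentiable (by simp)
  have hb1 := hb.differentiable (by simp)
  have hg1 := hg.differentiable (by simp)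
  have hη1 := hη.differentiable (by simp)
  have hax : Differentiable ℝ (pdx a) :=
    (contDiff_pdx (n := 1) (by simpa [one_add_one_eq_two] using ha)).differentiable (by simp)
  have hay : Differentiable ℝ (pdy a) :=
    (contDiff_pdy (n := 1) (by simpa [one_add_one_eq_two] using ha)).differentiable (by simp)
  have hbx : Differentiable ℝ (pdx b) :=
    (contDiff_pdx (n := 1) (by simpa [one_add_one_eq_two] using hb)).differentiable (by simp)
  have hby : Differentiable ℝ (pdy b) :=
    (contDiff_pdy (n := 1) (by simpa [one_add_one_eq_two] using hb)).differentiable (by simp)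
  have hgp := hg0 p
  have egx : g p * pdx g p = a p * pdx a p + b p * pdx b p := by
    have h1 := (hasDerivAt_pdx hg1 p).pow 2
    have h2 := ((hasDerivAt_pdx ha1 p).pow 2).add ((hasDerivAt_pdx hb1 p).pow 2)
    have h3 := h1.unique (h2.congr_of_eventuallyEq (.of_forall fun t => by simp [hgsq]))
    simp at h3
    linarith
  have egy : g p * pdy g p = a p * pdy a p + b p * pdy b p := by
    have h1 := (hasDerivAt_pdy hg1 p).pow 2
    have h2 := ((hasDerivAt_pdy ha1 p).pow 2).add ((hasDerivAt_pdy hb1 p).pow 2)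
    have h3 := h1.unique (h2.congr_of_eventuallyEq (.of_forall fun t => by simp [hgsq]))
    simp at h3
    linarith
  have e1 : pdx (fun q => g q * η q) p = pdx g p * η p + g p * pdx η p :=
    ((hasDerivAt_pdx hg1 p).mul (hasDerivAt_pdx hη1 p)).deriv
  have e2 : pdy (fun q => g q * η q) p = pdy g p * η p + g p * pdy η p :=
    ((hasDerivAt_pdy hg1 p).mul (hasDerivAt_pdy hη1 p)).deriv
  have e3 := (((hasDerivAt_pdx hη1 p).pow 2).mul
    (((hasDerivAt_pdx ha1 p).mul (hasDerivAt_pdx hax p)).add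
      ((hasDerivAt_pdx hb1 p).mul (hasDerivAt_pdx hbx p)))).deriv
  have e4 := ((((hasDerivAt_pdy hη1 p).pow 2).mul
    (((hasDerivAt_pdy ha1 p).mul (hasDerivAt_pdy hay p)).add
      ((hasDerivAt_pdy hb1 p).mul (hasDerivAt_pdy hby p)))).const_mul (p.1 ^ 2)).deriv
  replace e3 : pdx (fun q => η q ^ 2 * (a q * pdx a q + b q * pdx b q)) p = _ := e3
  replace e4 : pdy (fun q => q.1 ^ 2 * (η q ^ 2 * (a q * pdy a q + b q * pdy b q))) p = _ := e4
  have e5 : deltaG a p = pdx (pdx a) p + p.1 * (p.1 * pdy (pdy a) p) :=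
    congrArg (fun r => pdx (pdx a) p + p.1 * r) ((hasDerivAt_pdy hay p).const_mul p.1).deriv
  have e6 : deltaG b p = pdx (pdx b) p + p.1 * (p.1 * pdy (pdy b) p) :=
    congrArg (fun r => pdx (pdx b) p + p.1 * r) ((hasDerivAt_pdy hby p).const_mul p.1).deriv
  have modulus {r s t : ℝ} (h : g p * t = a p * r + b p * s) :
      t ^ 2 + ((a p * s - b p * r) / g p) ^ 2 = r ^ 2 + s ^ 2 := by
    field_simp
    linear_combination (g p * t + (a p * r + b p * s)) * h - (r ^ 2 + s ^ 2) * hgsq p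
  have kx := modulus egx
  have ky := modulus egy
  have kY : ((a p * (p.1 * pdy b p) - b p * (p.1 * pdy a p)) / g p) ^ 2 =
      p.1 ^ 2 * ((a p * pdy b p - b p * pdy a p) / g p) ^ 2 := by ring
  rw [e3, e4, e5, e6]
  simp only [Xg, Yg, e1, e2, kY, Pi.pow_apply, Nat.cast_ofNat, Nat.add_one_sub_one, pow_one]
  generalize ((a p * pdx b p - b p * pdx a p) / g p) ^ 2 = K at *
  generalize ((a p * pdy b p - b p * pdy a p) / g p) ^ 2 = L at *
  simp only [Pi.mul_apply, Pi.add_apply]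
  linear_combination η p ^ 2 * kx + η p ^ 2 * p.1 ^ 2 * ky +
    2 * η p * pdx η p * egx + 2 * η p * p.1 ^ 2 * pdy η p * egy

lemma normG_sq (u : ℝ × ℝ → ℝ) (p : ℝ × ℝ) : normG u p ^ 2 = Xg u p ^ 2 + Yg u p ^ 2 :=
  Real.sq_sqrt (by positivity)

lemma normG_nonneg (u : ℝ × ℝ → ℝ) (p : ℝ × ℝ) : 0 ≤ normG u p := Real.sqrt_nonneg _

lemma contDiff_Yg {f : ℝ × ℝ → ℝ} {n : ℕ} (hf : ContDiff ℝ (n + 1) f) : ContDiff ℝ n (Yg f) :=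
  contDiff_fst.mul (contDiff_pdy hf)

lemma contDiff_normG {u : ℝ × ℝ → ℝ} {n : ℕ} (hu : ContDiff ℝ (n + 1) u)
    (h : ∀ p, normG u p ≠ 0) : ContDiff ℝ n (normG u) := by
  refine ContDiff.sqrt (((contDiff_pdx hu).pow 2).add ((contDiff_Yg hu).pow 2)) fun p hp => h p ?_
  rw [normG]
  exact Real.sqrt_eq_zero'.2 hp.le

/-- The Grushin Laplacian of `Xu`, up to the commutator term. -/
lemma deltaG_Xg {u : ℝ × ℝ → ℝ} (hu : ContDiff ℝ 3 u) (p : ℝ × ℝ) :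
    deltaG (Xg u) p = pdx (deltaG u) p - 2 * Zg (Yg u) p := by
  have h2 : ContDiff ℝ 2 u := hu.of_le (by norm_num)
  have hx : ContDiff ℝ 2 (pdx u) := contDiff_pdx (n := 2) (by exact_mod_cast hu)
  have hy : ContDiff ℝ 2 (pdy u) := contDiff_pdy (n := 2) (by exact_mod_cast hu)
  have hxx : ContDiff ℝ 1 (pdx (pdx u)) := contDiff_pdx (n := 1) (by exact_mod_cast hx)
  have hyy : ContDiff ℝ 1 (pdy (pdy u)) := contDiff_pdy (n := 1) (by exact_mod_cast hy)
  have eYY (v : ℝ × ℝ → ℝ) (hv : ContDiff ℝ 2 v) (q : ℝ × ℝ) :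
      pdy (Yg v) q = q.1 * pdy (pdy v) q :=
    ((hasDerivAt_pdy ((contDiff_pdy (n := 1) (by exact_mod_cast hv)).differentiable (by simp))
      q).const_mul q.1).deriv
  have e1 : deltaG u = fun q => pdx (pdx u) q + q.1 * (q.1 * pdy (pdy u) q) := by
    funext q
    exact congrArg (fun r => pdx (pdx u) q + q.1 * r) (eYY u h2 q)
  have e2 : pdx (deltaG u) p = pdx (pdx (pdx u)) p +
      (2 * p.1 * pdy (pdy u) p + p.1 ^ 2 * pdx (pdy (pdy u)) p) := by
    rw [e1]
    refine ((hasDerivAt_pdx (hxx.differentiable (by simp)) p).add ((hasDerivAt_id p.1).mul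
      ((hasDerivAt_id p.1).mul
        (hasDerivAt_pdx (hyy.differentiable (by simp)) p)))).deriv.trans ?_
    simp
    ring
  have e3 : deltaG (Xg u) p = pdx (pdx (pdx u)) p + p.1 * (p.1 * pdy (pdy (pdx u)) p) :=
    congrArg (fun r => pdx (pdx (pdx u)) p + p.1 * r) (eYY _ hx p)
  have e4 : pdy (pdy (pdx u)) = pdx (pdy (pdy u)) := by
    rw [← pdx_pdy_comm h2, pdx_pdy_comm hy]
  rw [e2, e3, e4, Zg, eYY u h2]
  ring

/-- The Grushin Laplacian of `Yu`, up to the commutator term. -/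
lemma deltaG_Yg {u : ℝ × ℝ → ℝ} (hu : ContDiff ℝ 3 u) (p : ℝ × ℝ) :
    deltaG (Yg u) p = p.1 * pdy (deltaG u) p + 2 * Zg (Xg u) p := by
  have h2 : ContDiff ℝ 2 u := hu.of_le (by norm_num)
  have hx : ContDiff ℝ 2 (pdx u) := contDiff_pdx (n := 2) (by exact_mod_cast hu)
  have hy : ContDiff ℝ 2 (pdy u) := contDiff_pdy (n := 2) (by exact_mod_cast hu)
  have hxx : ContDiff ℝ 1 (pdx (pdx u)) := contDiff_pdx (n := 1) (by exact_mod_cast hx)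
  have hyx : ContDiff ℝ 1 (pdx (pdy u)) := contDiff_pdx (n := 1) (by exact_mod_cast hy)
  have hyy : ContDiff ℝ 1 (pdy (pdy u)) := contDiff_pdy (n := 1) (by exact_mod_cast hy)
  have eYY (q : ℝ × ℝ) : pdy (Yg u) q = q.1 * pdy (pdy u) q :=
    ((hasDerivAt_pdy (hy.differentiable (by simp)) q).const_mul q.1).deriv
  have e1 : deltaG u = fun q => pdx (pdx u) q + q.1 * (q.1 * pdy (pdy u) q) := by
    funext q
    exact congrArg (fun r => pdx (pdx u) q + q.1 * r) (eYY q)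
  have e2 : pdy (deltaG u) p = pdy (pdx (pdx u)) p +
      p.1 * (p.1 * pdy (pdy (pdy u)) p) := by
    rw [e1]
    exact ((hasDerivAt_pdy (hxx.differentiable (by simp)) p).add
      (((hasDerivAt_pdy (hyy.differentiable (by simp)) p).const_mul p.1).const_mul p.1)).deriv
  have e3 : pdx (Yg u) = fun q => pdy u q + q.1 * pdx (pdy u) q := by
    funext q
    refine (((hasDerivAt_id q.1).mul
      (hasDerivAt_pdx (hy.differentiable (by simp)) q))).deriv.trans ?_
    simp
  have e4 : pdx (pdx (Yg u)) p = 2 * pdx (pdy u) p + p.1 * pdx (pdx (pdy u)) p := by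
    rw [e3]
    refine ((hasDerivAt_pdx (hy.differentiable (by simp)) p).add
      ((hasDerivAt_id p.1).mul
        (hasDerivAt_pdx (hyx.differentiable (by simp)) p))).deriv.trans ?_
    simp
    ring
  have e5 : pdy (pdy (Yg u)) p = p.1 * pdy (pdy (pdy u)) p := by
    rw [funext eYY]
    exact ((hasDerivAt_pdy (hyy.differentiable (by simp)) p).const_mul p.1).deriv
  have e6 : pdy (Yg (Yg u)) p = p.1 * pdy (pdy (Yg u)) p := by
    refine ((hasDerivAt_pdy (f := pdy (Yg u)) ?_ p).const_mul p.1).deriv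
    rw [funext eYY]
    exact differentiable_fst.mul (hyy.differentiable (by simp))
  have e7 : deltaG (Yg u) p = pdx (pdx (Yg u)) p + p.1 * (p.1 * (p.1 * pdy (pdy (pdy u)) p)) := by
    rw [← e5, ← e6]
    rfl
  have e8 : pdx (pdx (pdy u)) = pdy (pdx (pdx u)) := by
    rw [pdx_pdy_comm h2, pdx_pdy_comm hx]
  have e9 : Zg (Xg u) p = pdx (pdy u) p := by
    rw [pdx_pdy_comm h2]
    rfl
  rw [e2, e7, e4, e8, e9]
  ring

lemma fderiv_apply_eq_sum_pdH {m : ℕ} (F : (Fin m → ℝ) → ℝ) (v w : Fin m → ℝ) :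
    fderiv ℝ F v w = ∑ j, pdH F j v * w j := by
  conv_lhs => rw [pi_eq_sum_univ' w]
  simp [pdH, mul_comm]

lemma pdx_comp {m : ℕ} {F : (Fin m → ℝ) → ℝ} (hF : Differentiable ℝ F)
    {u : Fin m → ℝ × ℝ → ℝ} (hu : ∀ i, Differentiable ℝ (u i)) (p : ℝ × ℝ) :
    pdx (fun q => F fun j => u j q) p = ∑ j, pdH F j (fun k => u k p) * pdx (u j) p := by
  rw [← fderiv_apply_eq_sum_pdH]
  exact ((hF _).hasFDerivAt.comp_hasDerivAt p.1
    (hasDerivAt_pi.2 fun j => hasDerivAt_pdx (hu j) p)).deriv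

lemma pdy_comp {m : ℕ} {F : (Fin m → ℝ) → ℝ} (hF : Differentiable ℝ F)
    {u : Fin m → ℝ × ℝ → ℝ} (hu : ∀ i, Differentiable ℝ (u i)) (p : ℝ × ℝ) :
    pdy (fun q => F fun j => u j q) p = ∑ j, pdH F j (fun k => u k p) * pdy (u j) p := by
  rw [← fderiv_apply_eq_sum_pdH]
  exact ((hF _).hasFDerivAt.comp_hasDerivAt p.2
    (hasDerivAt_pi.2 fun j => hasDerivAt_pdy (hu j) p)).deriv

/-- A smooth cutoff, logarithmic in the Grushin norm: it is `1` where
`1 + x⁴ + y² ≤ exp K` and `0` where `1 + x⁴ + y² ≥ exp (2K)`. -/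
noncomputable def logCutoff (K : ℝ) (p : ℝ × ℝ) : ℝ :=
  smoothTransition (2 - log (1 + (p.1 ^ 4 + p.2 ^ 2)) / K)

lemma contDiff_logCutoff (K : ℝ) {n : ℕ} : ContDiff ℝ n (logCutoff K) := by
  have h : ContDiff ℝ n fun p : ℝ × ℝ => log (1 + (p.1 ^ 4 + p.2 ^ 2)) :=
    ContDiff.log (by fun_prop) fun p => by positivity
  exact (smoothTransition.contDiff (n := n)).comp (contDiff_const.sub (h.div_const K))

lemma logCutoff_nonneg (K : ℝ) (p : ℝ × ℝ) : 0 ≤ logCutoff K p := smoothTransition.nonneg _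

lemma log_one_add_grushin_nonneg (p : ℝ × ℝ) : 0 ≤ log (1 + (p.1 ^ 4 + p.2 ^ 2)) :=
  log_nonneg (by linarith [show 0 ≤ p.1 ^ 4 + p.2 ^ 2 by positivity])

lemma logCutoff_mono {K L : ℝ} (hK : 0 < K) (h : K ≤ L) (p : ℝ × ℝ) :
    logCutoff K p ≤ logCutoff L p := by
  refine smoothTransition.monotone (sub_le_sub_left ?_ _)
  exact div_le_div_of_nonneg_left (log_one_add_grushin_nonneg p) hK h

lemma logCutoff_eq_one {K : ℝ} (hK : 0 < K) {p : ℝ × ℝ}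
    (h : log (1 + (p.1 ^ 4 + p.2 ^ 2)) ≤ K) : logCutoff K p = 1 := by
  refine smoothTransition.one_of_one_le ?_
  have := (div_le_one hK).2 h
  linarith

lemma hasCompactSupport_logCutoff {K : ℝ} (hK : 0 < K) : HasCompactSupport (logCutoff K) := by
  refine HasCompactSupport.of_support_subset_isCompact
    (isCompact_closedBall (0 : ℝ × ℝ) (exp (2 * K))) fun p hp => ?_
  have h1 : log (1 + (p.1 ^ 4 + p.2 ^ 2)) < 2 * K := by
    by_contra! h
    refine hp (smoothTransition.zero_of_nonpos ?_)
    have := (le_div_iff₀ hK).2 h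
    linarith
  have h2 : 1 + (p.1 ^ 4 + p.2 ^ 2) < exp (2 * K) := (log_lt_iff_lt_exp (by positivity)).1 h1
  rw [mem_closedBall_zero_iff, Prod.norm_def, max_le_iff, Real.norm_eq_abs, Real.norm_eq_abs]
  have hx : p.1 ^ 4 = (|p.1| ^ 2) ^ 2 := by rw [sq_abs]; ring
  constructor
  · nlinarith [sq_nonneg (|p.1| - 1), sq_nonneg (|p.1| ^ 2 - 1), sq_nonneg p.2]
  · nlinarith [sq_nonneg (|p.2| - 1), sq_abs p.2, sq_nonneg (p.1 ^ 2)]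

lemma deriv_smoothTransition_of_nonpos {s : ℝ} (hs : s ≤ 0) : deriv smoothTransition s = 0 := by
  refine IsLocalMin.deriv_eq_zero (Filter.Eventually.of_forall fun t => ?_)
  rw [smoothTransition.zero_of_nonpos hs]
  exact smoothTransition.nonneg t

lemma deriv_smoothTransition_of_one_le {s : ℝ} (hs : 1 ≤ s) : deriv smoothTransition s = 0 := by
  refine IsLocalMax.deriv_eq_zero (Filter.Eventually.of_forall fun t => ?_)
  rw [smoothTransition.one_of_one_le hs]
  exact smoothTransition.le_one t

lemma exists_sq_deriv_smoothTransition_le :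
    ∃ M : ℝ, 0 ≤ M ∧ ∀ s, deriv smoothTransition s ^ 2 ≤ M := by
  have hc : Continuous (deriv smoothTransition) :=
    (smoothTransition.contDiff (n := 1)).continuous_deriv (by simp)
  obtain ⟨M, hM⟩ := isCompact_Icc.bddAbove_image ((hc.pow 2).continuousOn (s := Set.Icc 0 1))
  refine ⟨max M 0, le_max_right _ _, fun s => ?_⟩
  rcases le_total s 0 with h0 | h0
  · simp [deriv_smoothTransition_of_nonpos h0]
  rcases le_total 1 s with h1 | h1
  · simp [deriv_smoothTransition_of_one_le h1]
  · exact (hM ⟨s, ⟨h0, h1⟩, rfl⟩).trans (le_max_left _ _)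

lemma logCutoff_grad_sq {K : ℝ} (hK : 0 < K) (p : ℝ × ℝ) :
    Xg (logCutoff K) p ^ 2 + Yg (logCutoff K) p ^ 2 ≤
      deriv smoothTransition (2 - log (1 + (p.1 ^ 4 + p.2 ^ 2)) / K) ^ 2 *
        (16 / K ^ 2 * (p.1 ^ 2 / (1 + (p.1 ^ 4 + p.2 ^ 2)))) := by
  have hq : 0 < 1 + (p.1 ^ 4 + p.2 ^ 2) := by positivity
  have hφ (s : ℝ) : HasDerivAt smoothTransition (deriv smoothTransition s) s :=
    ((smoothTransition.contDiff (n := 1)).differentiable (by simp) s).hasDerivAt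
  generalize hd : deriv smoothTransition (2 - log (1 + (p.1 ^ 4 + p.2 ^ 2)) / K) = d
  have ex : Xg (logCutoff K) p = d * -(4 * p.1 ^ 3 / (1 + (p.1 ^ 4 + p.2 ^ 2)) / K) := by
    have h : HasDerivAt (fun t : ℝ => 2 - log (1 + (t ^ 4 + p.2 ^ 2)) / K)
        (-(4 * p.1 ^ 3 / (1 + (p.1 ^ 4 + p.2 ^ 2)) / K)) p.1 := by
      have h0 : HasDerivAt (fun t : ℝ => 1 + (t ^ 4 + p.2 ^ 2)) (4 * p.1 ^ 3) p.1 := by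
        simpa using ((hasDerivAt_pow 4 p.1).add_const (p.2 ^ 2)).const_add 1
      exact ((h0.log hq.ne').div_const K).const_sub 2
    rw [← hd]
    exact ((hφ _).comp p.1 h).deriv
  have ey : pdy (logCutoff K) p = d * -(2 * p.2 / (1 + (p.1 ^ 4 + p.2 ^ 2)) / K) := by
    have h : HasDerivAt (fun t : ℝ => 2 - log (1 + (p.1 ^ 4 + t ^ 2)) / K)
        (-(2 * p.2 / (1 + (p.1 ^ 4 + p.2 ^ 2)) / K)) p.2 := by
      have h0 : HasDerivAt (fun t : ℝ => 1 + (p.1 ^ 4 + t ^ 2)) (2 * p.2) p.2 := by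
        simpa using ((hasDerivAt_pow 2 p.2).const_add (p.1 ^ 4)).const_add 1
      exact ((h0.log hq.ne').div_const K).const_sub 2
    rw [← hd]
    exact ((hφ _).comp p.2 h).deriv
  rw [Yg, ex, ey]
  have key : (16 * p.1 ^ 6 + 4 * p.1 ^ 2 * p.2 ^ 2) / (1 + (p.1 ^ 4 + p.2 ^ 2)) ^ 2 ≤
      16 * (p.1 ^ 2 / (1 + (p.1 ^ 4 + p.2 ^ 2))) := by
    rw [mul_div_assoc', div_le_div_iff₀ (by positivity) hq]
    have : 16 * p.1 ^ 6 + 4 * p.1 ^ 2 * p.2 ^ 2 ≤ 16 * p.1 ^ 2 * (1 + (p.1 ^ 4 + p.2 ^ 2)) := by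
      nlinarith [sq_nonneg p.1, sq_nonneg (p.1 * p.2)]
    nlinarith
  calc _ = d ^ 2 * ((16 * p.1 ^ 6 + 4 * p.1 ^ 2 * p.2 ^ 2) /
        (1 + (p.1 ^ 4 + p.2 ^ 2)) ^ 2 / K ^ 2) := by
        field_simp
        ring
    _ ≤ d ^ 2 * (16 * (p.1 ^ 2 / (1 + (p.1 ^ 4 + p.2 ^ 2))) / K ^ 2) := by gcongr
    _ = _ := by ring

lemma isOpen_ballG (R : ℝ) : IsOpen (ballG R) :=
  isOpen_lt (by fun_prop) continuous_const

lemma integrableOn_ballG {f : ℝ × ℝ → ℝ} (hf : Continuous f) (R : ℝ) :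
    IntegrableOn f (ballG R) := by
  refine (hf.continuousOn.integrableOn_compact
    (isCompact_closedBall (0 : ℝ × ℝ) (1 + R ^ 4))).mono_set fun p hp => ?_
  replace hp : p.1 ^ 4 + p.2 ^ 2 < R ^ 4 := hp
  rw [mem_closedBall_zero_iff, Prod.norm_def, max_le_iff, Real.norm_eq_abs, Real.norm_eq_abs]
  have hx : p.1 ^ 4 = (|p.1| ^ 2) ^ 2 := by rw [sq_abs]; ring
  constructor
  · nlinarith [sq_nonneg (|p.1| - 1), sq_nonneg (|p.1| ^ 2 - 1), sq_nonneg p.2]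
  · nlinarith [sq_nonneg (|p.2| - 1), sq_abs p.2, sq_nonneg (p.1 ^ 2)]

lemma inv_one_add_le_sum_indicator {K : ℕ} {p : ℝ × ℝ}
    (h : log (1 + (p.1 ^ 4 + p.2 ^ 2)) < 2 * K) :
    (1 + (p.1 ^ 4 + p.2 ^ 2))⁻¹ ≤ ∑ j ∈ Finset.range (2 * K),
      exp (-j) * (ballG (exp ((j + 1) / 4))).indicator 1 p := by
  have hq : 0 < 1 + (p.1 ^ 4 + p.2 ^ 2) := by positivity
  have hl := log_one_add_grushin_nonneg p
  set j := ⌊log (1 + (p.1 ^ 4 + p.2 ^ 2))⌋₊ with hj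
  have h1 : (j : ℝ) ≤ log (1 + (p.1 ^ 4 + p.2 ^ 2)) := Nat.floor_le hl
  have h2 : log (1 + (p.1 ^ 4 + p.2 ^ 2)) < j + 1 := Nat.lt_floor_add_one _
  have hmem : j ∈ Finset.range (2 * K) := by
    rw [Finset.mem_range]
    exact_mod_cast h1.trans_lt h
  have hball : p ∈ ballG (exp ((j + 1) / 4)) := by
    have : 1 + (p.1 ^ 4 + p.2 ^ 2) < exp (j + 1) := (log_lt_iff_lt_exp hq).1 h2
    show p.1 ^ 4 + p.2 ^ 2 < exp ((j + 1) / 4) ^ 4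
    rw [← exp_nat_mul]
    have e : ((4 : ℕ) : ℝ) * ((j + 1) / 4) = j + 1 := by push_cast; ring
    rw [e]
    linarith
  calc (1 + (p.1 ^ 4 + p.2 ^ 2))⁻¹ ≤ exp (-j) := by
        rw [exp_neg]
        exact inv_anti₀ (exp_pos _) ((le_log_iff_exp_le hq).1 h1)
    _ = exp (-j) * (ballG (exp ((j + 1) / 4))).indicator 1 p := by simp [hball]
    _ ≤ _ := Finset.single_le_sum
        (f := fun j : ℕ => exp (-j) * (ballG (exp ((j + 1) / 4))).indicator 1 p)
        (fun i _ => mul_nonneg (exp_pos _).le (Set.indicator_nonneg (by simp) _)) hmem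

/-- Under quartic growth of the weighted mass of `f`, the logarithmic cutoffs have small weighted
Grushin energy. -/
lemma exists_integral_logCutoff_grad_sq_le : ∃ M : ℝ, ∀ (f : ℝ × ℝ → ℝ) (C : ℝ),
    Continuous f → (∀ p, 0 ≤ f p) →
    (∀ R > (1 : ℝ), (∫ p in ballG R, p.1 ^ 2 * f p) ≤ C * R ^ 4) → ∀ K : ℕ, 0 < K →
    ∫ p, f p * (Xg (logCutoff K) p ^ 2 + Yg (logCutoff K) p ^ 2) ≤ M * C / K := by
  obtain ⟨M, hM0, hM⟩ := exists_sq_deriv_smoothTransition_le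
  refine ⟨32 * M * exp 1, fun f C hf hf0 hgrow K hK => ?_⟩
  have hK' : (0 : ℝ) < K := by exact_mod_cast hK
  have hint (j : ℕ) : Integrable ((ballG (exp ((j + 1) / 4))).indicator
      fun p => p.1 ^ 2 * f p) :=
    (integrableOn_ballG (by fun_prop) _).integrable_indicator (isOpen_ballG _).measurableSet
  have hpt (p : ℝ × ℝ) : f p * (Xg (logCutoff K) p ^ 2 + Yg (logCutoff K) p ^ 2) ≤
      ∑ j ∈ Finset.range (2 * K), 16 * M / K ^ 2 * exp (-j) *
        (ballG (exp ((j + 1) / 4))).indicator (fun p => p.1 ^ 2 * f p) p := by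
    have e (j : ℕ) : (ballG (exp ((j + 1) / 4))).indicator (fun p => p.1 ^ 2 * f p) p =
        (ballG (exp ((j + 1) / 4))).indicator 1 p * (p.1 ^ 2 * f p) := by
      by_cases h : p ∈ ballG (exp ((j + 1) / 4)) <;> simp [h]
    have hf0p := hf0 p
    refine (mul_le_mul_of_nonneg_left (logCutoff_grad_sq hK' p) hf0p).trans ?_
    rcases lt_or_ge (log (1 + (p.1 ^ 4 + p.2 ^ 2))) (2 * K) with h | h
    · have h1 := inv_one_add_le_sum_indicator h
      calc _ ≤ f p * (M * (16 / K ^ 2 * (p.1 ^ 2 / (1 + (p.1 ^ 4 + p.2 ^ 2))))) := by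
            gcongr
            exact hM _
        _ = 16 * M / K ^ 2 * (p.1 ^ 2 * f p) * (1 + (p.1 ^ 4 + p.2 ^ 2))⁻¹ := by ring
        _ ≤ 16 * M / K ^ 2 * (p.1 ^ 2 * f p) * ∑ j ∈ Finset.range (2 * K),
              exp (-j) * (ballG (exp ((j + 1) / 4))).indicator 1 p := by gcongr
        _ = _ := by
            rw [Finset.mul_sum]
            refine Finset.sum_congr rfl fun j _ => ?_
            rw [e]
            ring
    · rw [deriv_smoothTransition_of_nonpos (by have := (le_div_iff₀ hK').2 h; linarith)]
      simp only [ne_eq, OfNat.ofNat_ne_zero, not_false_eq_true, zero_pow, zero_mul, mul_zero]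
      refine Finset.sum_nonneg fun j _ => mul_nonneg (by positivity) ?_
      exact Set.indicator_nonneg (fun q _ => mul_nonneg (sq_nonneg _) (hf0 q)) _
  calc _ ≤ ∫ p, ∑ j ∈ Finset.range (2 * K), 16 * M / K ^ 2 * exp (-j) *
        (ballG (exp ((j + 1) / 4))).indicator (fun p => p.1 ^ 2 * f p) p := by
        refine integral_mono_of_nonneg (.of_forall fun p => ?_)
          (integrable_finsetSum _ fun j _ => (hint j).const_mul _) (.of_forall hpt)
        exact mul_nonneg (hf0 p) (by positivity)
    _ = ∑ j ∈ Finset.range (2 * K), 16 * M / K ^ 2 * exp (-j) *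
        ∫ p in ballG (exp ((j + 1) / 4)), p.1 ^ 2 * f p := by
        rw [integral_finsetSum _ fun j _ => (hint j).const_mul _]
        refine Finset.sum_congr rfl fun j _ => ?_
        rw [integral_const_mul, integral_indicator (isOpen_ballG _).measurableSet]
    _ ≤ ∑ j ∈ Finset.range (2 * K), 16 * M / K ^ 2 * exp 1 * C := by
        refine Finset.sum_le_sum fun j _ => ?_
        have h := hgrow (exp ((j + 1) / 4)) (one_lt_exp_iff.2 (by positivity))
        rw [← exp_nat_mul, show ((4 : ℕ) : ℝ) * ((j + 1) / 4) = j + 1 by push_cast; ring] at h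
        refine (mul_le_mul_of_nonneg_left h (by positivity)).trans_eq ?_
        rw [exp_add, exp_neg]
        field_simp
    _ = _ := by
        rw [Finset.sum_const, Finset.card_range, nsmul_eq_mul]
        push_cast
        field_simp
        ring

lemma modulus_mul_deltaG_le {m : ℕ} {H : Fin m → (Fin m → ℝ) → ℝ}
    (hH : ∀ i, ContDiff ℝ 1 (H i)) {u : Fin m → ℝ × ℝ → ℝ} (hu : ∀ i, ContDiff ℝ 3 (u i))
    (hsys : ∀ i p, deltaG (u i) p = H i (fun j => u j p))
    (hsign : ∀ i p, Zg (Yg (u i)) p * Xg (u i) p - Zg (Xg (u i)) p * Yg (u i) p ≤ 0)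
    (i : Fin m) (p : ℝ × ℝ) :
    ∑ j, pdH (H i) j (fun k => u k p) * (Xg (u i) p * Xg (u j) p + Yg (u i) p * Yg (u j) p) ≤
      Xg (u i) p * deltaG (Xg (u i)) p + Yg (u i) p * deltaG (Yg (u i)) p := by
  have hu1 (j : Fin m) : Differentiable ℝ (u j) := (hu j).differentiable (by simp)
  have hH1 : Differentiable ℝ (H i) := (hH i).differentiable (by simp)
  have e : deltaG (u i) = fun q => H i fun j => u j q := funext (hsys i)
  rw [deltaG_Xg (hu i), deltaG_Yg (hu i), e, pdx_comp hH1 hu1, pdy_comp hH1 hu1]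
  have h : ∑ j, pdH (H i) j (fun k => u k p) *
        (Xg (u i) p * Xg (u j) p + Yg (u i) p * Yg (u j) p) =
      Xg (u i) p * ∑ j, pdH (H i) j (fun k => u k p) * pdx (u j) p +
      Yg (u i) p * (p.1 * ∑ j, pdH (H i) j (fun k => u k p) * pdy (u j) p) := by
    simp only [Finset.mul_sum, ← Finset.sum_add_distrib]
    refine Finset.sum_congr rfl fun j _ => ?_
    simp only [Xg, Yg]
    ring
  rw [h]
  linarith [hsign i p]

/-- A geometric Poincaré inequality for stable solutions along which the system is orientable;
`σ` records the signs of the orientation. -/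
lemma integral_cutoff_mul_tangential_sq_le {m : ℕ} {H : Fin m → (Fin m → ℝ) → ℝ}
    (hH : ∀ i, ContDiff ℝ 1 (H i)) (hsymm : ∀ i j v, pdH (H j) i v = pdH (H i) j v)
    {u : Fin m → ℝ × ℝ → ℝ} (hu : ∀ i, ContDiff ℝ 3 (u i))
    (hsys : ∀ i p, deltaG (u i) p = H i (fun j => u j p))
    (hstab : ∀ ζ : Fin m → ℝ × ℝ → ℝ, (∀ i, ContDiff ℝ 1 (ζ i)) →
      (∀ i, HasCompactSupport (ζ i)) →
      (-(∑ i, ∑ j, ∫ p, pdH (H j) i (fun k => u k p) * ζ i p * ζ j p))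
        ≤ ∑ i, ∫ p, ((Xg (ζ i) p) ^ 2 + (Yg (ζ i) p) ^ 2))
    {σ : Fin m → ℝ} (hσ : ∀ i, σ i ^ 2 = 1)
    (horient : ∀ i j, i ≠ j → ∀ p, pdH (H i) j (fun k => u k p) * σ i * σ j ≤ 0)
    (hsign : ∀ i p, Zg (Yg (u i)) p * Xg (u i) p - Zg (Xg (u i)) p * Yg (u i) p ≤ 0)
    (hnz : ∀ i p, normG (u i) p ≠ 0) {η : ℝ × ℝ → ℝ} (hη : ContDiff ℝ 1 η)
    (hηc : HasCompactSupport η) :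
    ∑ i, ∫ p, η p ^ 2 * ((Xg (u i) p * Xg (Yg (u i)) p - Yg (u i) p * Xg (Xg (u i)) p) /
        normG (u i) p) ^ 2 ≤
      ∑ i, ∫ p, normG (u i) p ^ 2 * (Xg η p ^ 2 + Yg η p ^ 2) := by
  have ha (i : Fin m) : ContDiff ℝ 2 (Xg (u i)) := contDiff_pdx (n := 2) (by exact_mod_cast hu i)
  have hb (i : Fin m) : ContDiff ℝ 2 (Yg (u i)) := contDiff_Yg (n := 2) (by exact_mod_cast hu i)
  have hg (i : Fin m) : ContDiff ℝ 1 (normG (u i)) :=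
    (contDiff_normG (n := 2) (by exact_mod_cast hu i) (hnz i)).of_le (by norm_num)
  have hax (i : Fin m) : ContDiff ℝ 1 (pdx (Xg (u i))) :=
    contDiff_pdx (n := 1) (by exact_mod_cast ha i)
  have hay (i : Fin m) : ContDiff ℝ 1 (pdy (Xg (u i))) :=
    contDiff_pdy (n := 1) (by exact_mod_cast ha i)
  have hbx (i : Fin m) : ContDiff ℝ 1 (pdx (Yg (u i))) :=
    contDiff_pdx (n := 1) (by exact_mod_cast hb i)
  have hby (i : Fin m) : ContDiff ℝ 1 (pdy (Yg (u i))) :=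
    contDiff_pdy (n := 1) (by exact_mod_cast hb i)
  have ha1 (i : Fin m) : ContDiff ℝ 1 (Xg (u i)) := (ha i).of_le (by norm_num)
  have hb1 (i : Fin m) : ContDiff ℝ 1 (Yg (u i)) := (hb i).of_le (by norm_num)
  have hσ0 (i : Fin m) : σ i ≠ 0 := fun h => by simpa [h] using hσ i
  have hgσ (i : Fin m) : ContDiff ℝ 1 fun p => σ i * normG (u i) p := contDiff_const.mul (hg i)
  let ζ (i : Fin m) (p : ℝ × ℝ) : ℝ := σ i * normG (u i) p * η p
  have hζ (i : Fin m) : ContDiff ℝ 1 (ζ i) := (hgσ i).mul hη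
  have hζc (i : Fin m) : HasCompactSupport (ζ i) := hηc.mul_left
  let F (i : Fin m) (q : ℝ × ℝ) : ℝ :=
    η q ^ 2 * (Xg (u i) q * pdx (Xg (u i)) q + Yg (u i) q * pdx (Yg (u i)) q)
  let G (i : Fin m) (q : ℝ × ℝ) : ℝ :=
    q.1 ^ 2 * (η q ^ 2 * (Xg (u i) q * pdy (Xg (u i)) q + Yg (u i) q * pdy (Yg (u i)) q))
  have hη2c : HasCompactSupport fun p => η p ^ 2 :=
    hηc.comp_left (g := fun t => t ^ 2) (by simp)
  have hF (i : Fin m) : ContDiff ℝ 1 (F i) :=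
    (hη.pow 2).mul (((ha1 i).mul (hax i)).add ((hb1 i).mul (hbx i)))
  have hG (i : Fin m) : ContDiff ℝ 1 (G i) :=
    (contDiff_fst.pow 2).mul ((hη.pow 2).mul (((ha1 i).mul (hay i)).add ((hb1 i).mul (hby i))))
  have hFc (i : Fin m) : HasCompactSupport (F i) := hη2c.mul_right
  have hGc (i : Fin m) : HasCompactSupport (G i) := (hη2c.mul_right).mul_left
  have iF (i : Fin m) : Integrable (pdx (F i)) :=
    (continuous_pdx (hF i)).integrable_of_hasCompactSupport
      ((hFc i).pdx ((hF i).differentiable (by simp)))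
  have iG (i : Fin m) : Integrable (pdy (G i)) :=
    (continuous_pdy (hG i)).integrable_of_hasCompactSupport
      ((hGc i).pdy ((hG i).differentiable (by simp)))
  have energy {f : ℝ × ℝ → ℝ} (hf : ContDiff ℝ 1 f) (hc : HasCompactSupport f) :
      Continuous (fun p => Xg f p ^ 2 + Yg f p ^ 2) ∧
        HasCompactSupport (fun p => Xg f p ^ 2 + Yg f p ^ 2) := by
    have hd := hf.differentiable (by simp)
    have hY : HasCompactSupport (Yg f) := (hc.pdy hd).mul_left
    refine ⟨((continuous_pdx hf).pow 2).add ((continuous_fst.mul (continuous_pdy hf)).pow 2), ?_⟩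
    simp only [sq]
    exact (HasCompactSupport.mul_left (hc.pdx hd)).add (HasCompactSupport.mul_left hY)
  have iE (i : Fin m) : Integrable fun p => Xg (ζ i) p ^ 2 + Yg (ζ i) p ^ 2 :=
    (energy (hζ i) (hζc i)).1.integrable_of_hasCompactSupport (energy (hζ i) (hζc i)).2
  have iη (i : Fin m) : Integrable fun p => normG (u i) p ^ 2 * (Xg η p ^ 2 + Yg η p ^ 2) :=
    (((hg i).continuous.pow 2).mul (energy hη hηc).1).integrable_of_hasCompactSupport
      (energy hη hηc).2.mul_left
  have iT (i j : Fin m) : Integrable fun p => pdH (H j) i (fun k => u k p) * ζ i p * ζ j p := by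
    refine Continuous.integrable_of_hasCompactSupport ?_ (hζc j).mul_left
    have h : Continuous fun p => pdH (H j) i (fun k => u k p) :=
      (((hH j).continuous_fderiv (by simp)).comp
        (continuous_pi fun k => (hu k).continuous)).clm_apply continuous_const
    exact (h.mul (hζ i).continuous).mul (hζ j).continuous
  have iD (i : Fin m) : Integrable fun p => η p ^ 2 *
      ((Xg (u i) p * Xg (Yg (u i)) p - Yg (u i) p * Xg (Xg (u i)) p) / normG (u i) p) ^ 2 := by
    refine Continuous.integrable_of_hasCompactSupport ?_ hη2c.mul_right
    exact (hη.continuous.pow 2).mul (((((ha i).continuous.mul (hbx i).continuous).sub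
      ((hb i).continuous.mul (hax i).continuous)).div (hg i).continuous (hnz i)).pow 2)
  have hcoupling (i j : Fin m) (p : ℝ × ℝ) : pdH (H j) i (fun k => u k p) * ζ i p * ζ j p ≤
      η p ^ 2 * (pdH (H i) j (fun k => u k p) *
        (Xg (u i) p * Xg (u j) p + Yg (u i) p * Yg (u j) p)) := by
    rw [hsymm]
    have si := normG_sq (u i) p
    have sj := normG_sq (u j) p
    rcases eq_or_ne i j with rfl | hij
    · refine le_of_eq ?_
      linear_combination pdH (H i) i (fun k => u k p) * η p ^ 2 *
        (normG (u i) p ^ 2 * hσ i + si)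
    · have hc := horient i j hij p
      have hCS : σ i * σ j * (Xg (u i) p * Xg (u j) p + Yg (u i) p * Yg (u j) p) ≤
          normG (u i) p * normG (u j) p := by
        refine abs_le_of_sq_le_sq' ?_ (mul_nonneg (normG_nonneg _ _) (normG_nonneg _ _)) |>.2
        rw [mul_pow, mul_pow, mul_pow, hσ, hσ, si, sj]
        nlinarith [sq_nonneg (Xg (u i) p * Yg (u j) p - Yg (u i) p * Xg (u j) p)]
      have h := mul_nonneg (sq_nonneg (η p)) (mul_nonneg (neg_nonneg.2 hc) (sub_nonneg.2 hCS))
      have hσσ : σ i ^ 2 * σ j ^ 2 = 1 := by rw [hσ, hσ, one_mul]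
      refine sub_nonneg.1 (h.trans_eq ?_)
      simp only [ζ]
      linear_combination η p ^ 2 * pdH (H i) j (fun k => u k p) *
        (Xg (u i) p * Xg (u j) p + Yg (u i) p * Yg (u j) p) * hσσ
  have hpt (i : Fin m) (p : ℝ × ℝ) : Xg (ζ i) p ^ 2 + Yg (ζ i) p ^ 2 +
      ∑ j, pdH (H j) i (fun k => u k p) * ζ i p * ζ j p ≤
      normG (u i) p ^ 2 * (Xg η p ^ 2 + Yg η p ^ 2) + (pdx (F i) p + pdy (G i) p) -
        η p ^ 2 * ((Xg (u i) p * Xg (Yg (u i)) p - Yg (u i) p * Xg (Xg (u i)) p) /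
          normG (u i) p) ^ 2 := by
    have hid := grushin_energy_modulus_identity (ha i) (hb i) (hgσ i) hη
      (fun p => mul_ne_zero (hσ0 i) (hnz i p))
      (fun p => by rw [mul_pow, hσ, one_mul, normG_sq]) p
    have hsum := (Finset.sum_le_sum fun j (_ : j ∈ Finset.univ) => hcoupling i j p).trans_eq
      (Finset.mul_sum _ _ _).symm
    have hle := mul_le_mul_of_nonneg_left (modulus_mul_deltaG_le hH hu hsys hsign i p)
      (sq_nonneg (η p))
    have hL := mul_nonneg (sq_nonneg (η p)) (sq_nonneg ((Xg (u i) p * Yg (Yg (u i)) p -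
      Yg (u i) p * Yg (Xg (u i)) p) / (σ i * normG (u i) p)))
    have hD (r : ℝ) : (r / (σ i * normG (u i) p)) ^ 2 = (r / normG (u i) p) ^ 2 := by
      rw [div_pow, div_pow, mul_pow, hσ, one_mul]
    rw [hD (Xg (u i) p * Xg (Yg (u i)) p - Yg (u i) p * Xg (Xg (u i)) p), mul_pow, hσ,
      one_mul] at hid
    simp only [ζ, F, G] at hsum ⊢
    linarith
  have h0 : 0 ≤ ∑ i, ∫ p, (Xg (ζ i) p ^ 2 + Yg (ζ i) p ^ 2 +
      ∑ j, pdH (H j) i (fun k => u k p) * ζ i p * ζ j p) := by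
    have h := hstab ζ hζ hζc
    have e (i : Fin m) : ∫ p, (Xg (ζ i) p ^ 2 + Yg (ζ i) p ^ 2 +
        ∑ j, pdH (H j) i (fun k => u k p) * ζ i p * ζ j p) =
        (∫ p, (Xg (ζ i) p ^ 2 + Yg (ζ i) p ^ 2)) +
          ∑ j, ∫ p, pdH (H j) i (fun k => u k p) * ζ i p * ζ j p := by
      rw [integral_add (iE i) (integrable_finsetSum _ fun j _ => iT i j),
        integral_finsetSum _ fun j _ => iT i j]
    simp only [e, Finset.sum_add_distrib]
    linarith
  have h1 (i : Fin m) : ∫ p, (Xg (ζ i) p ^ 2 + Yg (ζ i) p ^ 2 +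
      ∑ j, pdH (H j) i (fun k => u k p) * ζ i p * ζ j p) ≤
      (∫ p, normG (u i) p ^ 2 * (Xg η p ^ 2 + Yg η p ^ 2)) -
        ∫ p, η p ^ 2 * ((Xg (u i) p * Xg (Yg (u i)) p - Yg (u i) p * Xg (Xg (u i)) p) /
          normG (u i) p) ^ 2 := by
    refine (integral_mono ((iE i).add (integrable_finsetSum _ fun j _ => iT i j))
      (((iη i).add ((iF i).add (iG i))).sub (iD i)) (hpt i)).trans_eq ?_
    rw [integral_sub' ((iη i).add ((iF i).add (iG i))) (iD i),
      integral_add' (iη i) ((iF i).add (iG i)), integral_add' (iF i) (iG i),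
      integral_pdx_eq_zero (hF i) (hFc i), integral_pdy_eq_zero (hG i) (hGc i)]
    ring
  have h2 := h0.trans (Finset.sum_le_sum fun i (_ : i ∈ Finset.univ) => h1 i)
  rw [Finset.sum_sub_distrib] at h2
  linarith

/-- If the direction of the Grushin gradient is constant along horizontal lines, then `u` does not
depend on `y`, because the gradient is horizontal on the axis `x = 0`. -/
lemma pdy_eq_zero_of_tangential_eq_zero {u : ℝ × ℝ → ℝ} (hu : ContDiff ℝ 2 u)
    (hnz : ∀ p, normG u p ≠ 0)
    (h : ∀ p, Xg u p * Xg (Yg u) p - Yg u p * Xg (Xg u) p = 0) (p : ℝ × ℝ) : pdy u p = 0 := by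
  have ha : Differentiable ℝ (Xg u) :=
    (contDiff_pdx (n := 1) (by exact_mod_cast hu)).differentiable (by simp)
  have hb : Differentiable ℝ (Yg u) :=
    (contDiff_Yg (n := 1) (by exact_mod_cast hu)).differentiable (by simp)
  have hg : Differentiable ℝ (normG u) :=
    (contDiff_normG (n := 1) (by exact_mod_cast hu) hnz).differentiable (by simp)
  have hquot (x y : ℝ) : HasDerivAt (fun t => Yg u (t, y) / normG u (t, y)) 0 x := by
    have h1 := (hasDerivAt_pdx hb (x, y)).div (hasDerivAt_pdx hg (x, y)) (hnz (x, y))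
    have h2 := (hasDerivAt_pdx hg (x, y)).pow 2
    have h3 := ((hasDerivAt_pdx ha (x, y)).pow 2).add ((hasDerivAt_pdx hb (x, y)).pow 2)
    have h4 := h2.unique (h3.congr_of_eventuallyEq (.of_forall fun t => by simp [normG_sq]))
    have h5 := h (x, y)
    have h6 := normG_sq u (x, y)
    refine h1.congr_deriv ?_
    have h0 := hnz (x, y)
    simp only [Xg, Nat.cast_ofNat, Nat.add_one_sub_one, pow_one] at h4 h5 h6
    rw [div_eq_zero_iff]
    left
    refine (mul_eq_zero.1 (?_ : normG u (x, y) * _ = 0)).resolve_left h0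
    linear_combination pdx (Yg u) (x, y) * h6 - Yg u (x, y) / 2 * h4 + pdx u (x, y) * h5
  have hY (x y : ℝ) : Yg u (x, y) = 0 := by
    have h1 := is_const_of_deriv_eq_zero (fun t => (hquot t y).differentiableAt)
      (fun t => (hquot t y).deriv) x 0
    have h2 : Yg u (0, y) = 0 := zero_mul _
    rw [h2, zero_div] at h1
    exact (div_eq_zero_iff.1 h1).resolve_right (hnz _)
  have hc : Continuous fun t => pdy u (t, p.2) :=
    (continuous_pdy (hu.of_le (by norm_num))).comp (by fun_prop)
  have hext := hc.ext_on (dense_compl_singleton (0 : ℝ)) continuous_const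
    (g := fun _ => (0 : ℝ)) fun t ht => (mul_eq_zero.1 (hY t p.2)).resolve_left ht
  exact congrFun hext p.1

/-- One-dimensional symmetry for stable, orientable solutions of the
symmetric Grushin system on `ℝ²`: under the sign, nondegeneracy and growth assumptions,
each `u_i` depends only on the variable `x`. -/
theorem stmt_15 {m : ℕ}
    (H : Fin m → (Fin m → ℝ) → ℝ) (hH : ∀ i, ContDiff ℝ 1 (H i))
    (hsymm : ∀ i j v, pdH (H j) i v = pdH (H i) j v)
    (u : Fin m → ℝ × ℝ → ℝ) (hu : ∀ i, ContDiff ℝ 3 (u i))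
    (hsys : ∀ i p, deltaG (u i) p = H i (fun j => u j p))
    -- stability
    (hstab : ∀ ζ : Fin m → ℝ × ℝ → ℝ, (∀ i, ContDiff ℝ 1 (ζ i)) →
      (∀ i, HasCompactSupport (ζ i)) →
      (-(∑ i, ∑ j, ∫ p, pdH (H j) i (fun k => u k p) * ζ i p * ζ j p))
        ≤ ∑ i, ∫ p, ((Xg (ζ i) p) ^ 2 + (Yg (ζ i) p) ^ 2))
    -- orientability along u
    (horient : ∃ θ : Fin m → ℝ × ℝ → ℝ,
      (∀ i, (∀ p, 0 < θ i p) ∨ (∀ p, θ i p < 0)) ∧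
      (∀ i j, i ≠ j → ∀ p, pdH (H i) j (fun k => u k p) * θ i p * θ j p < 0))
    -- sign assumption on the commutator terms
    (hsign : ∀ i p, Zg (Yg (u i)) p * Xg (u i) p - Zg (Xg (u i)) p * Yg (u i) p ≤ 0)
    -- nonvanishing Grushin gradient
    (hnz : ∀ i p, normG (u i) p ≠ 0)
    -- growth-decay assumption
    (C : ℝ)
    (hgrow : ∀ R > (1 : ℝ), ∀ i,
      (∫ p in ballG R, p.1 ^ 2 * (normG (u i) p) ^ 2) ≤ C * R ^ 4) :
    (∀ i p, pdy (u i) p = 0) ∧ ∀ i, ∀ x y y' : ℝ, u i (x, y) = u i (x, y') := by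
  obtain ⟨θ, hθ, hθH⟩ := horient
  obtain ⟨σ, hσ, hσθ⟩ : ∃ σ : Fin m → ℝ, (∀ i, σ i ^ 2 = 1) ∧ ∀ i p, 0 < σ i * θ i p := by
    suffices h : ∀ i, ∃ s : ℝ, s ^ 2 = 1 ∧ ∀ p, 0 < s * θ i p by
      choose σ h using h
      exact ⟨σ, fun i => (h i).1, fun i => (h i).2⟩
    intro i
    rcases hθ i with h | h
    · exact ⟨1, by norm_num, fun p => by simpa using h p⟩
    · exact ⟨-1, by norm_num, fun p => by simpa using h p⟩
  have hσH (i j : Fin m) (hij : i ≠ j) (p : ℝ × ℝ) :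
      pdH (H i) j (fun k => u k p) * σ i * σ j ≤ 0 := by
    by_contra! hpos
    have h1 := mul_pos hpos (mul_pos (hσθ i p) (hσθ j p))
    have h2 : σ i ^ 2 * σ j ^ 2 = 1 := by rw [hσ, hσ, one_mul]
    refine (hθH i j hij p).not_gt (h1.trans_eq ?_)
    linear_combination pdH (H i) j (fun k => u k p) * θ i p * θ j p * h2
  obtain ⟨M, hM⟩ := exists_integral_logCutoff_grad_sq_le
  have hcont (i : Fin m) : Continuous fun p =>
      ((Xg (u i) p * Xg (Yg (u i)) p - Yg (u i) p * Xg (Xg (u i)) p) / normG (u i) p) ^ 2 := by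
    have ha : ContDiff ℝ 2 (Xg (u i)) := contDiff_pdx (n := 2) (by exact_mod_cast hu i)
    have hb : ContDiff ℝ 2 (Yg (u i)) := contDiff_Yg (n := 2) (by exact_mod_cast hu i)
    exact (((ha.continuous.mul (continuous_pdx (hb.of_le (by norm_num)))).sub
      (hb.continuous.mul (continuous_pdx (ha.of_le (by norm_num))))).div
      (contDiff_normG (n := 2) (by exact_mod_cast hu i) (hnz i)).continuous (hnz i)).pow 2
  have hηc (K : ℕ) (hK : 0 < K) : HasCompactSupport fun p => logCutoff K p ^ 2 :=
    (hasCompactSupport_logCutoff (Nat.cast_pos.2 hK)).comp_left (g := fun t => t ^ 2) (by simp)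
  have hηcont (K : ℕ) : Continuous fun p => logCutoff K p ^ 2 :=
    (contDiff_logCutoff K (n := 0)).continuous.pow 2
  have hint (i : Fin m) (K : ℕ) (hK : 0 < K) : Integrable fun p => logCutoff K p ^ 2 *
      ((Xg (u i) p * Xg (Yg (u i)) p - Yg (u i) p * Xg (Xg (u i)) p) / normG (u i) p) ^ 2 :=
    ((hηcont K).mul (hcont i)).integrable_of_hasCompactSupport (hηc K hK).mul_right
  have hbound (i : Fin m) (K : ℕ) (hK : 0 < K) : ∫ p, logCutoff K p ^ 2 *
      ((Xg (u i) p * Xg (Yg (u i)) p - Yg (u i) p * Xg (Xg (u i)) p) / normG (u i) p) ^ 2 ≤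
      (m * (M * C)) / K := by
    refine (Finset.single_le_sum (f := fun i => ∫ p, logCutoff K p ^ 2 *
      ((Xg (u i) p * Xg (Yg (u i)) p - Yg (u i) p * Xg (Xg (u i)) p) / normG (u i) p) ^ 2)
      (fun l _ => integral_nonneg fun p => by positivity) (Finset.mem_univ i)).trans ?_
    refine (integral_cutoff_mul_tangential_sq_le hH hsymm hu hsys hstab hσ hσH hsign hnz
      (contDiff_logCutoff K (n := 1)) (hasCompactSupport_logCutoff (Nat.cast_pos.2 hK))).trans ?_
    refine (Finset.sum_le_sum fun l _ => hM (fun p => normG (u l) p ^ 2) C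
      ((contDiff_normG (n := 2) (by exact_mod_cast hu l) (hnz l)).continuous.pow 2)
      (fun p => sq_nonneg _) (fun R hR => hgrow R hR l) K hK).trans_eq ?_
    rw [Finset.sum_const, Finset.card_univ, Fintype.card_fin, nsmul_eq_mul, ← mul_div_assoc]
  have hzero (i : Fin m) (p : ℝ × ℝ) :
      Xg (u i) p * Xg (Yg (u i)) p - Yg (u i) p * Xg (Xg (u i)) p = 0 := by
    obtain ⟨K, hK⟩ := exists_nat_ge (max 1 (log (1 + (p.1 ^ 4 + p.2 ^ 2))))
    have hK1 : 0 < K := Nat.cast_pos.1 (zero_lt_one.trans_le ((le_max_left _ _).trans hK))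
    have hle : ∫ p, logCutoff K p ^ 2 *
        ((Xg (u i) p * Xg (Yg (u i)) p - Yg (u i) p * Xg (Xg (u i)) p) / normG (u i) p) ^ 2 ≤
        0 := by
      refine ge_of_tendsto (tendsto_const_div_atTop_nhds_zero_nat (m * (M * C))) ?_
      filter_upwards [eventually_ge_atTop K] with L hL
      refine (integral_mono (hint i K hK1) (hint i L (hK1.trans_le hL)) fun q => ?_).trans
        (hbound i L (hK1.trans_le hL))
      have h1 := logCutoff_mono (Nat.cast_pos.2 hK1) (Nat.cast_le.2 hL) q
      have h2 := logCutoff_nonneg K q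
      dsimp only
      gcongr
    by_contra hne
    refine hle.not_gt (Continuous.integral_pos_of_hasCompactSupport_nonneg_nonzero (x := p)
      ((hηcont K).mul (hcont i)) (hηc K hK1).mul_right (fun q => ?_) ?_)
    · exact mul_nonneg (sq_nonneg _) (sq_nonneg _)
    · rw [logCutoff_eq_one (Nat.cast_pos.2 hK1) ((le_max_right _ _).trans hK)]
      simpa [hnz i p] using hne
  have hy (i : Fin m) (p : ℝ × ℝ) : pdy (u i) p = 0 :=
    pdy_eq_zero_of_tangential_eq_zero ((hu i).of_le (by norm_num)) (hnz i) (hzero i) p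
  refine ⟨hy, fun i x y y' => ?_⟩
  have hd := (hu i).differentiable (by simp)
  exact is_const_of_deriv_eq_zero (f := fun t => u i (x, t))
    (fun t => (hasDerivAt_pdy hd (x, t)).differentiableAt)
    (fun t => hy i (x, t)) y y'
end

section
/- Let Ω ⊆ ℝ² be open and u ∈ C²(Ω) with |∇_G u(p)| ≠ 0 for every p ∈ Ω, and suppose the intrinsic curvature of the level sets of u vanishes identically on Ω: (XXu)(Yu)² − (XYu)(Xu)(Yu) − (YXu)(Xu)(Yu) + (YYu)(Xu)² = 0 on Ω. Let λ ∈ ℝ and let γ ∈ C²((t₁,t₂),ℝ) satisfy (t,γ(t)) ∈ Ω, u(t,γ(t)) = λ, and ∂_y u(t,γ(t)) ≠ 0 for all t ∈ (t₁,t₂). Then the function t ↦ γ′(t)/√(γ′(t)² + t²) is constant on (t₁,t₂); consequently, if (t₁,t₂) ⊆ (0,∞), there exist constants a, b ∈ ℝ such that γ(t) = a·t² + b for all t ∈ (t₁,t₂), i.e. the level curve is an arc of a parabola. -/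
open MeasureTheory Real Filter

theorem pdx_eq_fderiv_s16 {v : ℝ × ℝ → ℝ} {p : ℝ × ℝ} (hv : DifferentiableAt ℝ v p) :
    pdx v p = fderiv ℝ v p (1, 0) := by
  have h : HasDerivAt (fun t : ℝ => (t, p.2)) ((1 : ℝ), (0 : ℝ)) p.1 :=
    (hasDerivAt_id p.1).prodMk (hasDerivAt_const p.1 p.2)
  exact (HasFDerivAt.comp_hasDerivAt (f := fun t : ℝ => (t, p.2)) p.1 hv.hasFDerivAt h).deriv

theorem pdy_eq_fderiv_s16 {v : ℝ × ℝ → ℝ} {p : ℝ × ℝ} (hv : DifferentiableAt ℝ v p) :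
    pdy v p = fderiv ℝ v p (0, 1) := by
  have h : HasDerivAt (fun t : ℝ => (p.1, t)) ((0 : ℝ), (1 : ℝ)) p.2 :=
    (hasDerivAt_const p.2 p.1).prodMk (hasDerivAt_id p.2)
  exact (HasFDerivAt.comp_hasDerivAt (f := fun t : ℝ => (p.1, t)) p.2 hv.hasFDerivAt h).deriv

theorem hasDerivAt_comp_graph {v : ℝ × ℝ → ℝ} {γ : ℝ → ℝ} {t m : ℝ}
    (hv : DifferentiableAt ℝ v (t, γ t)) (hγ : HasDerivAt γ m t) :
    HasDerivAt (fun s => v (s, γ s)) (pdx v (t, γ t) + pdy v (t, γ t) * m) t := by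
  have h : HasDerivAt (fun s : ℝ => (s, γ s)) ((1 : ℝ), m) t := (hasDerivAt_id t).prodMk hγ
  have key := HasFDerivAt.comp_hasDerivAt (f := fun s : ℝ => (s, γ s)) t hv.hasFDerivAt h
  have e : ((1 : ℝ), m) = (1, 0) + m • ((0 : ℝ), (1 : ℝ)) := by ext <;> simp
  rw [e, map_add, map_smul, smul_eq_mul, mul_comm m, ← pdx_eq_fderiv_s16 hv,
    ← pdy_eq_fderiv_s16 hv] at key
  exact key

theorem differentiableAt_fderiv_of_contDiffAt_two {v : ℝ × ℝ → ℝ} {p : ℝ × ℝ}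
    (hv : ContDiffAt ℝ 2 v p) : DifferentiableAt ℝ (fderiv ℝ v) p :=
  (hv.fderiv_right (m := 1) (by norm_num)).differentiableAt one_ne_zero

theorem eventually_differentiableAt_of_contDiffAt_two {v : ℝ × ℝ → ℝ} {p : ℝ × ℝ}
    (hv : ContDiffAt ℝ 2 v p) : ∀ᶠ q in nhds p, DifferentiableAt ℝ v q :=
  (hv.eventually (by simp)).mono fun _ hq => hq.differentiableAt two_ne_zero

theorem differentiableAt_pdx {v : ℝ × ℝ → ℝ} {p : ℝ × ℝ} (hv : ContDiffAt ℝ 2 v p) :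
    DifferentiableAt ℝ (pdx v) p :=
  ((differentiableAt_fderiv_of_contDiffAt_two hv).clm_apply
    (differentiableAt_const _)).congr_of_eventuallyEq
    ((eventually_differentiableAt_of_contDiffAt_two hv).mono fun _ hq => pdx_eq_fderiv_s16 hq)

theorem differentiableAt_pdy {v : ℝ × ℝ → ℝ} {p : ℝ × ℝ} (hv : ContDiffAt ℝ 2 v p) :
    DifferentiableAt ℝ (pdy v) p :=
  ((differentiableAt_fderiv_of_contDiffAt_two hv).clm_apply
    (differentiableAt_const _)).congr_of_eventuallyEq
    ((eventually_differentiableAt_of_contDiffAt_two hv).mono fun _ hq => pdy_eq_fderiv_s16 hq)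

theorem Xg_Yg_eq {v : ℝ × ℝ → ℝ} {p : ℝ × ℝ} (hv : DifferentiableAt ℝ (pdy v) p) :
    Xg (Yg v) p = pdy v p + p.1 * pdx (pdy v) p := by
  have h : DifferentiableAt ℝ (fun t : ℝ => pdy v (t, p.2)) p.1 :=
    DifferentiableAt.comp (f := fun t : ℝ => (t, p.2)) p.1 hv (by fun_prop)
  have key : Xg (Yg v) p = _ := ((hasDerivAt_id p.1).mul h.hasDerivAt).deriv
  rw [key]
  simp [pdx]

theorem Yg_Yg_eq (v : ℝ × ℝ → ℝ) (p : ℝ × ℝ) :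
    Yg (Yg v) p = p.1 ^ 2 * pdy (pdy v) p := by
  have h : pdy (Yg v) p = p.1 * pdy (pdy v) p :=
    deriv_const_mul_field (v := fun t => pdy v (p.1, t)) p.1
  rw [Yg, h]
  ring

/-- A function with vanishing derivative on an open interval is constant there. -/
theorem exists_eq_const_of_hasDerivAt_zero {f : ℝ → ℝ} {a b : ℝ}
    (hf : ∀ t ∈ Set.Ioo a b, HasDerivAt f 0 t) : ∃ c, ∀ t ∈ Set.Ioo a b, f t = c :=
  isOpen_Ioo.exists_is_const_of_deriv_eq_zero isPreconnected_Ioo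
    (fun t ht => (hf t ht).differentiableAt.differentiableWithinAt) fun t ht => (hf t ht).deriv

/-- The slope `m` of a level curve of vanishing curvature satisfies `t (t m' - m) = 0`. -/
theorem slope_ode_of_curvature_eq_zero {A B B' C p q t m n : ℝ} (hq : q ≠ 0)
    (h1 : p + q * m = 0) (h2 : A + B * m + ((B' + C * m) * m + q * n) = 0)
    (h : A * (t * q) ^ 2 - (q + t * B') * p * (t * q) - t * B * p * (t * q)
      + t ^ 2 * C * p ^ 2 = 0) : t * (t * n - m) = 0 := by
  obtain rfl : p = -(q * m) := by linarith
  have : q ^ 3 * (t * (t * n - m)) = 0 := by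
    linear_combination t ^ 2 * q ^ 2 * h2 - h
  simpa [hq] using this

theorem hasDerivAt_div_sqrt_sq_add_sq {f : ℝ → ℝ} {t n : ℝ} (hf : HasDerivAt f n t)
    (hpos : 0 < f t ^ 2 + t ^ 2) (hode : t * (t * n - f t) = 0) :
    HasDerivAt (fun s => f s / √(f s ^ 2 + s ^ 2)) 0 t := by
  have hs := ((hf.pow 2).add (hasDerivAt_pow 2 t)).sqrt hpos.ne'
  have hne : √(f t ^ 2 + t ^ 2) ≠ 0 := (Real.sqrt_pos.2 hpos).ne'
  refine (hf.div hs hne).congr_deriv ?_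
  have hsq := Real.sq_sqrt hpos.le
  simp only [Pi.add_apply, Pi.pow_apply]
  set r := √(f t ^ 2 + t ^ 2)
  field_simp
  push_cast
  linear_combination 2 * n * hsq + 2 * hode

/-- Level curves of Grushin-harmonic-curvature functions are parabolic:
if the intrinsic curvature of the level sets vanishes identically and the level curve is a
graph `y = γ(x)` with `∂_y u ≠ 0` along it, then `γ′/√(γ′² + t²)` is constant, and on an
interval of positive `t`'s the curve is an arc of a parabola `γ(t) = a t² + b`. -/
theorem stmt_16 (Ω : Set (ℝ × ℝ)) (hΩ : IsOpen Ω)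
    (u : ℝ × ℝ → ℝ) (hu : ContDiffOn ℝ 2 u Ω)
    (hnz : ∀ p ∈ Ω, normG u p ≠ 0)
    (hcurv : ∀ p ∈ Ω,
      Xg (Xg u) p * (Yg u p) ^ 2 - Xg (Yg u) p * Xg u p * Yg u p
        - Yg (Xg u) p * Xg u p * Yg u p + Yg (Yg u) p * (Xg u p) ^ 2 = 0)
    (lam t₁ t₂ : ℝ) (γ : ℝ → ℝ)
    (hγ : ContDiffOn ℝ 2 γ (Set.Ioo t₁ t₂))
    (hmem : ∀ t ∈ Set.Ioo t₁ t₂, (t, γ t) ∈ Ω)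
    (hlev : ∀ t ∈ Set.Ioo t₁ t₂, u (t, γ t) = lam)
    (hy : ∀ t ∈ Set.Ioo t₁ t₂, pdy u (t, γ t) ≠ 0) :
    (∃ c : ℝ, ∀ t ∈ Set.Ioo t₁ t₂,
      deriv γ t / Real.sqrt ((deriv γ t) ^ 2 + t ^ 2) = c) ∧
    (Set.Ioo t₁ t₂ ⊆ Set.Ioi (0 : ℝ) →
      ∃ a b : ℝ, ∀ t ∈ Set.Ioo t₁ t₂, γ t = a * t ^ 2 + b) := by
  have hC : ∀ t ∈ Set.Ioo t₁ t₂, ContDiffAt ℝ 2 u (t, γ t) := fun t ht =>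
    hu.contDiffAt (hΩ.mem_nhds (hmem t ht))
  have hγ1 : ∀ t ∈ Set.Ioo t₁ t₂, HasDerivAt γ (deriv γ t) t := fun t ht =>
    ((hγ.contDiffAt (isOpen_Ioo.mem_nhds ht)).differentiableAt two_ne_zero).hasDerivAt
  have hγ2 : ∀ t ∈ Set.Ioo t₁ t₂, HasDerivAt (deriv γ) (deriv (deriv γ) t) t := fun t ht =>
    (((hγ.deriv_of_isOpen isOpen_Ioo (m := 1) (by norm_num)).contDiffAt
      (isOpen_Ioo.mem_nhds ht)).differentiableAt one_ne_zero).hasDerivAt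
  have hfirst : ∀ t ∈ Set.Ioo t₁ t₂,
      pdx u (t, γ t) + pdy u (t, γ t) * deriv γ t = 0 := fun t ht =>
    (hasDerivAt_comp_graph ((hC t ht).differentiableAt two_ne_zero) (hγ1 t ht)).unique
      ((hasDerivAt_const t lam).congr_of_eventuallyEq
        (Filter.eventually_of_mem (isOpen_Ioo.mem_nhds ht) hlev))
  have hode : ∀ t ∈ Set.Ioo t₁ t₂, t * (t * deriv (deriv γ) t - deriv γ t) = 0 := by
    intro t ht
    have hsecond := ((hasDerivAt_comp_graph (differentiableAt_pdx (hC t ht)) (hγ1 t ht)).add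
      ((hasDerivAt_comp_graph (differentiableAt_pdy (hC t ht)) (hγ1 t ht)).mul
        (hγ2 t ht))).unique
      ((hasDerivAt_const t (0 : ℝ)).congr_of_eventuallyEq
        (Filter.eventually_of_mem (isOpen_Ioo.mem_nhds ht) hfirst))
    have h := hcurv _ (hmem t ht)
    rw [Xg_Yg_eq (differentiableAt_pdy (hC t ht)), Yg_Yg_eq] at h
    exact slope_ode_of_curvature_eq_zero (hy t ht) (hfirst t ht) hsecond h
  have hpos : ∀ t ∈ Set.Ioo t₁ t₂, 0 < deriv γ t ^ 2 + t ^ 2 := by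
    intro t ht
    refine (add_nonneg (sq_nonneg _) (sq_nonneg _)).lt_of_ne' fun h0 => hnz _ (hmem t ht) ?_
    obtain ⟨h1, h2⟩ := (add_eq_zero_iff_of_nonneg (sq_nonneg _) (sq_nonneg _)).1 h0
    have hx : pdx u (t, γ t) = 0 := by simpa [pow_eq_zero_iff two_ne_zero |>.1 h1] using hfirst t ht
    simp [normG, Xg, Yg, hx, mul_pow, h2]
  refine ⟨exists_eq_const_of_hasDerivAt_zero fun t ht =>
    hasDerivAt_div_sqrt_sq_add_sq (hγ2 t ht) (hpos t ht) (hode t ht), fun hsub => ?_⟩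
  obtain ⟨k, hk⟩ : ∃ k, ∀ t ∈ Set.Ioo t₁ t₂, deriv γ t / t = k := by
    refine exists_eq_const_of_hasDerivAt_zero fun t ht => ?_
    have h0 : t ≠ 0 := (hsub ht).ne'
    refine ((hγ2 t ht).div (hasDerivAt_id t) h0).congr_deriv ?_
    have h := (mul_eq_zero.1 (hode t ht)).resolve_left h0
    simp only [id]
    rw [div_eq_zero_iff]
    left
    linarith
  obtain ⟨b, hb⟩ : ∃ b, ∀ t ∈ Set.Ioo t₁ t₂, γ t - k / 2 * t ^ 2 = b := by
    refine exists_eq_const_of_hasDerivAt_zero fun t ht => ?_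
    have h := (div_eq_iff (hsub ht).ne').1 (hk t ht)
    refine ((hγ1 t ht).sub ((hasDerivAt_pow 2 t).const_mul (k / 2))).congr_deriv ?_
    rw [h]
    push_cast
    ring
  exact ⟨k / 2, b, fun t ht => by linarith [hb t ht]⟩
end
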